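/- arXiv:1909.09622 — 3 statements merged into one kernel-verified Lean document; each statement's English description precedes it below -/
import Mathlib

section
/- Assume k ≥ 6, a(1) = 1, and |a(n)| ≤ d(n)·n^{(k−1)/2} for all n ≥ 1. Then Σ_{n≥2} |a(n)|·n^{−(k−1)} ≤ ζ((k−1)/2)² − 1 ≤ ζ(5/2)² − 1 < 1, and consequently for every x ∈ ℝ the value L(f⊗e(x), k−1) = Σ_{n≥1} a(n)e^{2πinx}n^{−(k−1)} satisfies 0 < 2 − ζ(5/2)² ≤ |L(f⊗e(x), k−1)| ≤ ζ(5/2)²; in particular L(f⊗e(x), k−1) is bounded above and bounded away from zero uniformly in x ∈ ℝ. -/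
open Complex MeasureTheory Real Filter

noncomputable section

/-- Partial sums of `∑ n ^ (-5/2)`, completed by an integral bound for the tail. -/
theorem sum_range_inv_rpow_five_halves_le (N : ℕ) :
    ∑ n ∈ Finset.range (N + 3), (((n : ℝ) + 1) ^ (5 / 2 : ℝ))⁻¹ +
      2 / 3 * (√((N : ℝ) + 3) ^ 3)⁻¹ ≤ 7 / 5 := by
  have rpow_eq (x : ℝ) (hx : 0 ≤ x) : x ^ (5 / 2 : ℝ) = √x ^ 5 := by
    rw [Real.sqrt_eq_rpow, ← Real.rpow_natCast, ← Real.rpow_mul hx]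
    norm_num
  induction N with
  | zero =>
    have h2 : (0 : ℝ) < √2 := by positivity
    have h3 : (0 : ℝ) < √3 := by positivity
    have e2 : √(2 : ℝ) ^ 2 = 2 := Real.sq_sqrt (by norm_num)
    have e3 : √(3 : ℝ) ^ 2 = 3 := Real.sq_sqrt (by norm_num)
    have l2 : (7 / 5 : ℝ) ≤ √2 := Real.le_sqrt_of_sq_le (by norm_num)
    have l3 : (17 / 10 : ℝ) ≤ √3 := Real.le_sqrt_of_sq_le (by norm_num)
    have p2 : √(2 : ℝ) ^ 5 = 4 * √2 := by
      rw [show √(2 : ℝ) ^ 5 = (√2 ^ 2) ^ 2 * √2 by ring, e2]; norm_num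
    have p3 : √(3 : ℝ) ^ 5 = 9 * √3 := by
      rw [show √(3 : ℝ) ^ 5 = (√3 ^ 2) ^ 2 * √3 by ring, e3]; norm_num
    have q3 : √(3 : ℝ) ^ 3 = 3 * √3 := by
      rw [show √(3 : ℝ) ^ 3 = √3 ^ 2 * √3 by ring, e3]
    have i2 : (√(2 : ℝ))⁻¹ ≤ (7 / 5)⁻¹ := inv_anti₀ (by norm_num) l2
    have i3 : (√(3 : ℝ))⁻¹ ≤ (17 / 10)⁻¹ := inv_anti₀ (by norm_num) l3
    simp only [Finset.sum_range_succ, Finset.sum_range_zero]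
    rw [rpow_eq _ (by positivity), rpow_eq _ (by positivity), rpow_eq _ (by positivity)]
    norm_num [p2, p3, q3] at i2 i3 ⊢
    linarith
  | succ N ih =>
    rw [show N + 1 + 3 = (N + 3) + 1 by ring, Finset.sum_range_succ, rpow_eq _ (by positivity)]
    push_cast
    rw [show (N : ℝ) + 1 + 3 = N + 3 + 1 by ring]
    set u := √((N : ℝ) + 3) with hu
    set v := √((N : ℝ) + 3 + 1) with hv
    have hu0 : 0 < u := Real.sqrt_pos.2 (by positivity)
    have huv : u ≤ v := Real.sqrt_le_sqrt (by linarith)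
    have hv0 : 0 < v := hu0.trans_le huv
    have eu : u ^ 2 = (N : ℝ) + 3 := Real.sq_sqrt (by positivity)
    have ev : v ^ 2 = u ^ 2 + 1 := by rw [eu]; exact Real.sq_sqrt (by positivity)
    have key : (v ^ 5)⁻¹ + 2 / 3 * (v ^ 3)⁻¹ ≤ 2 / 3 * (u ^ 3)⁻¹ := by
      have hpoly : 3 * u ^ 3 ≤ 2 * v ^ 2 * (v ^ 3 - u ^ 3) := by
        have hfac : (v ^ 3 - u ^ 3) * (v + u) = v ^ 2 + u * v + u ^ 2 := by
          linear_combination (v ^ 2 + u * v + u ^ 2) * ev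
        refine le_of_mul_le_mul_right ?_ (add_pos hv0 hu0)
        have h1 : u ^ 4 ≤ v ^ 4 := by gcongr
        have h2 : u ^ 3 * v ≤ v ^ 3 * v := by gcongr
        have h3 : u * u ^ 3 ≤ u * v ^ 3 := by gcongr
        have h4 : u ^ 2 * u ^ 2 ≤ u ^ 2 * v ^ 2 := by gcongr
        have h5 : u ^ 2 * (u * v) ≤ v ^ 2 * (u * v) := by gcongr
        calc 3 * u ^ 3 * (v + u) ≤ 2 * v ^ 2 * (v ^ 2 + u * v + u ^ 2) := by
              nlinarith
          _ = 2 * v ^ 2 * (v ^ 3 - u ^ 3) * (v + u) := by rw [mul_assoc (2 * v ^ 2), hfac]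
      have hdiff : 2 / 3 * (u ^ 3)⁻¹ - ((v ^ 5)⁻¹ + 2 / 3 * (v ^ 3)⁻¹) =
          (2 * v ^ 2 * (v ^ 3 - u ^ 3) - 3 * u ^ 3) / (3 * u ^ 3 * v ^ 5) := by
        field_simp
        ring
      have : 0 ≤ (2 * v ^ 2 * (v ^ 3 - u ^ 3) - 3 * u ^ 3) / (3 * u ^ 3 * v ^ 5) :=
        div_nonneg (by linarith) (by positivity)
      linarith
    linarith

theorem tsum_inv_rpow_five_halves_le :
    ∑' n : ℕ, (((n : ℝ) + 1) ^ (5 / 2 : ℝ))⁻¹ ≤ 7 / 5 := by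
  refine Real.tsum_le_of_sum_range_le (fun n => by positivity) fun N => ?_
  have hmono : ∑ n ∈ Finset.range N, (((n : ℝ) + 1) ^ (5 / 2 : ℝ))⁻¹ ≤
      ∑ n ∈ Finset.range (N + 3), (((n : ℝ) + 1) ^ (5 / 2 : ℝ))⁻¹ :=
    Finset.sum_le_sum_of_subset_of_nonneg (Finset.range_mono (by omega))
      fun n _ _ => by positivity
  have htail : 0 ≤ 2 / 3 * (√((N : ℝ) + 3) ^ 3)⁻¹ := by positivity
  linarith [sum_range_inv_rpow_five_halves_le N]

theorem summable_inv_add_one_rpow {s : ℝ} (hs : 1 < s) :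
    Summable fun n : ℕ => (((n : ℝ) + 1) ^ s)⁻¹ := by
  simpa using (summable_nat_add_iff 1).2 (Real.summable_nat_rpow_inv.2 hs)

theorem riemannZeta_ofReal_eq_tsum {s : ℝ} (hs : 1 < s) :
    riemannZeta s = ((∑' n : ℕ, (((n : ℝ) + 1) ^ s)⁻¹ : ℝ) : ℂ) := by
  rw [zeta_eq_tsum_one_div_nat_add_one_cpow (by simpa using hs), Complex.ofReal_tsum]
  refine tsum_congr fun n => ?_
  rw [one_div, Complex.ofReal_inv, Complex.ofReal_cpow (by positivity)]
  push_cast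
  rfl

/-- The Dirichlet series of the divisor function is `ζ ^ 2`. -/
theorem hasSum_card_divisors_div_rpow {s : ℝ} (hs : 1 < s) :
    HasSum (fun n : ℕ => (n.divisors.card : ℝ) / (n : ℝ) ^ s)
      ((∑' n : ℕ, (((n : ℝ) + 1) ^ s)⁻¹) ^ 2) := by
  have hs' : 1 < (s : ℂ).re := by simpa using hs
  have hζ := LSeriesHasSum_one hs'
  have h : HasSum (LSeries.term (LSeries.convolution 1 1) s) (riemannZeta s * riemannZeta s) :=
    hζ.convolution hζ
  rw [← Complex.hasSum_ofReal]
  rw [riemannZeta_ofReal_eq_tsum hs] at h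
  convert h using 1
  · funext n
    rcases eq_or_ne n 0 with rfl | hn
    · simp
    · have hconv : LSeries.convolution (1 : ℕ → ℂ) 1 n = n.divisors.card := by
        simp [LSeries.convolution_def, ← Nat.map_div_right_divisors]
      rw [LSeries.term_of_ne_zero hn, hconv]
      push_cast
      rw [Complex.ofReal_cpow n.cast_nonneg]
      simp
  · push_cast
    ring

theorem norm_div_pow_le_of_deligne {k n : ℕ} (hk : 1 ≤ k) (hn : 1 ≤ n) {z : ℂ}
    (hz : ‖z‖ ≤ (n.divisors.card : ℝ) * (n : ℝ) ^ (((k : ℝ) - 1) / 2)) :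
    ‖z‖ / (n : ℝ) ^ (k - 1) ≤ (n.divisors.card : ℝ) / (n : ℝ) ^ (((k : ℝ) - 1) / 2) := by
  have hn0 : (0 : ℝ) < n := by exact_mod_cast hn
  have hpow : (n : ℝ) ^ (k - 1) =
      (n : ℝ) ^ (((k : ℝ) - 1) / 2) * (n : ℝ) ^ (((k : ℝ) - 1) / 2) := by
    rw [← Real.rpow_add hn0, ← Real.rpow_natCast, Nat.cast_sub hk]
    congr 1
    push_cast
    ring
  have hr : 0 < (n : ℝ) ^ (((k : ℝ) - 1) / 2) := Real.rpow_pos_of_pos hn0 _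
  rw [hpow, div_le_div_iff₀ (by positivity) hr]
  nlinarith [mul_le_mul_of_nonneg_right hz hr.le]

/-- If `k ≥ 6`, `a(1) = 1` and the Deligne bound `|a(n)| ≤ d(n) n^{(k-1)/2}`
holds, then `∑_{n ≥ 2} |a(n)| n^{-(k-1)} ≤ ζ((k-1)/2)² - 1 ≤ ζ(5/2)² - 1 < 1`, and for every
`x ∈ ℝ` the additive twist value `L(f ⊗ e(x), k-1)` satisfies
`0 < 2 - ζ(5/2)² ≤ |L(f ⊗ e(x), k-1)| ≤ ζ(5/2)²`. -/
theorem L_value_bounded_away_from_zero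
    (k : ℕ) (hk : 6 ≤ k) (hke : Even k) (a : ℕ → ℂ)
    (ha1 : a 1 = 1)
    (hDeligne : ∀ n : ℕ, 1 ≤ n →
      ‖a n‖ ≤ (n.divisors.card : ℝ) * (n : ℝ) ^ (((k : ℝ) - 1) / 2))
    (zeta : ℝ → ℝ)
    (hzeta : ∀ s : ℝ, zeta s = ∑' n : ℕ, (((n : ℝ) + 1) ^ s)⁻¹)
    (L : ℝ → ℂ)
    (hL : ∀ x : ℝ, L x = ∑' n : ℕ,
      a (n + 1) * Complex.exp (2 * (π : ℂ) * I * ((n : ℂ) + 1) * (x : ℂ)) /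
        ((n : ℂ) + 1) ^ (k - 1)) :
    (∑' n : ℕ, ‖a (n + 2)‖ / ((n : ℝ) + 2) ^ (k - 1) ≤ zeta (((k : ℝ) - 1) / 2) ^ 2 - 1) ∧
    (zeta (((k : ℝ) - 1) / 2) ^ 2 - 1 ≤ zeta (5 / 2) ^ 2 - 1) ∧
    (zeta (5 / 2) ^ 2 - 1 < 1) ∧
    (0 < 2 - zeta (5 / 2) ^ 2) ∧
    (∀ x : ℝ, 2 - zeta (5 / 2) ^ 2 ≤ ‖L x‖ ∧ ‖L x‖ ≤ zeta (5 / 2) ^ 2) := by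
  have hk' : (6 : ℝ) ≤ k := by exact_mod_cast hk
  set s : ℝ := ((k : ℝ) - 1) / 2 with hs
  have hs52 : 5 / 2 ≤ s := by linarith
  have hs1 : 1 < s := by linarith
  have hD := hasSum_card_divisors_div_rpow hs1
  rw [← hzeta] at hD
  have hD2 : HasSum (fun n : ℕ => ((n + 2).divisors.card : ℝ) / ((n + 2 : ℕ) : ℝ) ^ s)
      (zeta s ^ 2 - 1) := by
    simpa [Finset.sum_range_succ] using (hasSum_nat_add_iff' 2).2 hD
  have hle (n : ℕ) : ‖a (n + 2)‖ / ((n : ℝ) + 2) ^ (k - 1) ≤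
      ((n + 2).divisors.card : ℝ) / ((n + 2 : ℕ) : ℝ) ^ s := by
    have := norm_div_pow_le_of_deligne (by omega) (by omega) (hDeligne (n + 2) (by omega))
    push_cast at this ⊢
    exact this
  have hsum : Summable fun n : ℕ => ‖a (n + 2)‖ / ((n : ℝ) + 2) ^ (k - 1) :=
    hD2.summable.of_nonneg_of_le (fun n => by positivity) hle
  have htail : ∑' n : ℕ, ‖a (n + 2)‖ / ((n : ℝ) + 2) ^ (k - 1) ≤ zeta s ^ 2 - 1 :=
    (hsum.tsum_le_tsum hle hD2.summable).trans_eq hD2.tsum_eq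
  have hpos : 0 ≤ zeta s := by
    rw [hzeta]
    exact tsum_nonneg fun n => by positivity
  have hmono : zeta s ≤ zeta (5 / 2) := by
    rw [hzeta, hzeta]
    refine (summable_inv_add_one_rpow hs1).tsum_le_tsum (fun n => ?_)
      (summable_inv_add_one_rpow (by norm_num))
    exact inv_anti₀ (by positivity) (Real.rpow_le_rpow_of_exponent_le (by simp) hs52)
  have hsq : zeta s ^ 2 ≤ zeta (5 / 2) ^ 2 := by gcongr
  have h75 : zeta (5 / 2) ≤ 7 / 5 := by
    rw [hzeta]
    exact tsum_inv_rpow_five_halves_le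
  have hlt : zeta (5 / 2) ^ 2 < 2 := by nlinarith [hpos.trans hmono]
  refine ⟨htail, by linarith, by linarith, by linarith, fun x => ?_⟩
  set F : ℕ → ℂ := fun n => a (n + 1) * Complex.exp (2 * (π : ℂ) * I * ((n : ℂ) + 1) * (x : ℂ)) /
    ((n : ℂ) + 1) ^ (k - 1) with hF
  have hnorm (n : ℕ) : ‖F n‖ = ‖a (n + 1)‖ / ((n : ℝ) + 1) ^ (k - 1) := by
    have hexp : ‖Complex.exp (2 * (π : ℂ) * I * ((n : ℂ) + 1) * (x : ℂ))‖ = 1 := by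
      rw [show 2 * (π : ℂ) * I * ((n : ℂ) + 1) * (x : ℂ) =
        ((2 * π * ((n : ℝ) + 1) * x : ℝ) : ℂ) * I by push_cast; ring]
      exact Complex.norm_exp_ofReal_mul_I _
    have hcast : ‖(n : ℂ) + 1‖ = (n : ℝ) + 1 := by
      exact_mod_cast Complex.norm_natCast (n + 1)
    rw [hF]
    simp only [norm_div, norm_mul, norm_pow, hexp, hcast, mul_one]
  have hnorm_succ (n : ℕ) : ‖F (n + 1)‖ = ‖a (n + 2)‖ / ((n : ℝ) + 2) ^ (k - 1) := by
    rw [hnorm]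
    push_cast
    ring_nf
  have hsumF : Summable fun n => ‖F (n + 1)‖ := by simpa only [hnorm_succ] using hsum
  have hF0 : ‖F 0‖ = 1 := by simp [hnorm, ha1]
  have hLx : L x = F 0 + ∑' n, F (n + 1) := by
    rw [hL]
    exact ((summable_nat_add_iff 1).1 hsumF.of_norm).tsum_eq_zero_add
  have hR : ‖∑' n, F (n + 1)‖ ≤ zeta (5 / 2) ^ 2 - 1 := by
    refine (norm_tsum_le_tsum_norm hsumF).trans ?_
    simp only [hnorm_succ]
    linarith
  rw [hLx]
  constructor
  · have := norm_sub_le_norm_add (F 0) (∑' n, F (n + 1))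
    linarith
  · have := norm_add_le (F 0) (∑' n, F (n + 1))
    linarith
end
end

section
/- Assume k ≥ 6 is an even integer, f is modular of weight k for Γ_0(N), a(1) = 1, and the Deligne bound |a(n)| ≤ d(n)·n^{(k−1)/2} holds for all n ≥ 1. Then there is a constant C depending only on k such that for every γ = (a b; c d) ∈ SL₂(ℤ) with N | c and c > 0, every complex zero x_0 of the period polynomial r_{f,γ} satisfies |x_0| ≤ C·(1 + |a/c|). -/
open Complex MeasureTheory Real Filter

noncomputable section

theorem rpow_neg_five_halves_le_sub (n : ℕ) (hn : 1 ≤ n) :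
    ((n : ℝ) + 1) ^ (-(5 / 2) : ℝ) ≤
      2 / 3 * (n : ℝ) ^ (-(3 / 2) : ℝ) - 2 / 3 * ((n : ℝ) + 1) ^ (-(3 / 2) : ℝ) := by
  have hn' : (1 : ℝ) ≤ n := by exact_mod_cast hn
  obtain ⟨x, hx0, hx⟩ : ∃ x : ℝ, 0 < x ∧ x ^ 2 = n :=
    ⟨√n, Real.sqrt_pos.2 (by linarith), Real.sq_sqrt (by linarith)⟩
  obtain ⟨y, hy0, hy⟩ : ∃ y : ℝ, 0 < y ∧ y ^ 2 = n + 1 :=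
    ⟨√(n + 1), Real.sqrt_pos.2 (by linarith), Real.sq_sqrt (by linarith)⟩
  have e5 : ((n : ℝ) + 1) ^ (-(5 / 2) : ℝ) = (y ^ 5)⁻¹ := by
    rw [← hy, ← Real.rpow_natCast y 2, ← Real.rpow_mul hy0.le, ← Real.rpow_natCast y 5,
      ← Real.rpow_neg hy0.le]
    norm_num
  have e3 : ((n : ℝ) + 1) ^ (-(3 / 2) : ℝ) = (y ^ 3)⁻¹ := by
    rw [← hy, ← Real.rpow_natCast y 2, ← Real.rpow_mul hy0.le, ← Real.rpow_natCast y 3,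
      ← Real.rpow_neg hy0.le]
    norm_num
  have e3' : (n : ℝ) ^ (-(3 / 2) : ℝ) = (x ^ 3)⁻¹ := by
    rw [← hx, ← Real.rpow_natCast x 2, ← Real.rpow_mul hx0.le, ← Real.rpow_natCast x 3,
      ← Real.rpow_neg hx0.le]
    norm_num
  rw [e5, e3, e3']
  have hxy : x < y := by nlinarith
  have h1 : 3 / 2 * x ≤ y ^ 3 - x ^ 3 := by
    have h : (y ^ 3 - x ^ 3) * (x + y) = y ^ 2 + x * y + x ^ 2 := by
      have : y ^ 2 - x ^ 2 = 1 := by linarith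
      linear_combination (y ^ 2 + x * y + x ^ 2) * this
    refine le_of_mul_le_mul_right ?_ (add_pos hx0 hy0)
    rw [h]
    nlinarith
  have h2 : 3 * x ^ 3 ≤ 2 * y ^ 2 * (y ^ 3 - x ^ 3) := by
    have : 2 * y ^ 2 * (3 / 2 * x) ≤ 2 * y ^ 2 * (y ^ 3 - x ^ 3) := by gcongr
    nlinarith [mul_pos hx0 (sub_pos.2 hxy)]
  have h3 : 2 / 3 * (x ^ 3)⁻¹ - 2 / 3 * (y ^ 3)⁻¹ - (y ^ 5)⁻¹
      = (2 * y ^ 2 * (y ^ 3 - x ^ 3) - 3 * x ^ 3) / (3 * x ^ 3 * y ^ 5) := by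
    field_simp
  have h4 : 0 ≤ (2 * y ^ 2 * (y ^ 3 - x ^ 3) - 3 * x ^ 3) / (3 * x ^ 3 * y ^ 5) :=
    div_nonneg (by linarith) (by positivity)
  linarith

theorem sum_rpow_neg_five_halves_le (n : ℕ) :
    ∑ i ∈ Finset.range n, ((i : ℝ) + 1) ^ (-(5 / 2) : ℝ) ≤ 7 / 5 := by
  have key : ∀ m : ℕ, ∑ i ∈ Finset.range (m + 4), ((i : ℝ) + 1) ^ (-(5 / 2) : ℝ)
      ≤ 7 / 5 - 2 / 3 * ((m : ℝ) + 4) ^ (-(3 / 2) : ℝ) := by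
    intro m
    induction m with
    | zero =>
      have e (z : ℝ) (hz : 0 < z) : z ^ (-(5 / 2) : ℝ) = √z / z ^ 3 := by
        rw [Real.sqrt_eq_rpow, ← Real.rpow_natCast, ← Real.rpow_sub hz]; norm_num
      have h2 : √2 ≤ 1.415 := Real.sqrt_le_iff.2 (by norm_num)
      have h3 : √3 ≤ 1.733 := Real.sqrt_le_iff.2 (by norm_num)
      simp only [Finset.sum_range_succ, Finset.sum_range_zero, Nat.cast_zero, zero_add,
        Nat.cast_ofNat, Nat.cast_one, Real.one_rpow]
      norm_num only
      norm_num only at e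
      rw [e 2 (by norm_num), e 3 (by norm_num)]
      linarith
    | succ m ih =>
      rw [show m + 1 + 4 = (m + 4) + 1 by ring, Finset.sum_range_succ]
      have := rpow_neg_five_halves_le_sub (m + 4) (by omega)
      push_cast at this ⊢
      rw [show (m : ℝ) + 1 + 4 = m + 4 + 1 by ring]
      linarith
  calc _ ≤ ∑ i ∈ Finset.range (n + 4), ((i : ℝ) + 1) ^ (-(5 / 2) : ℝ) :=
        Finset.sum_le_sum_of_subset_of_nonneg (Finset.range_mono (by omega))
          fun i _ _ => by positivity
    _ ≤ _ := (key n).trans (sub_le_self _ (by positivity))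

theorem exists_hasSum_card_divisors :
    ∃ σ : ℝ, σ < 2 ∧ HasSum
      (fun n : ℕ => ((n + 1).divisors.card : ℝ) * ((n : ℝ) + 1) ^ (-(5 / 2) : ℝ)) σ := by
  have hsum : Summable fun n : ℕ => ((n : ℝ) + 1) ^ (-(5 / 2) : ℝ) :=
    summable_of_sum_range_le (fun n => by positivity) sum_rpow_neg_five_halves_le
  obtain ⟨Z, hZ⟩ := hsum
  have hZ0 : 0 ≤ Z := hZ.nonneg fun n => by positivity
  have hZle : Z ≤ 7 / 5 := le_of_tendsto' hZ.tendsto_sum_nat sum_rpow_neg_five_halves_le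
  refine ⟨Z * Z, by nlinarith, ?_⟩
  have e : ∀ n : ℕ, (((n : ℝ) + 1) ^ (-(5 / 2) : ℝ) : ℝ) =
      (1 : ℂ) / ((n : ℂ) + 1) ^ ((5 / 2 : ℝ) : ℂ) := by
    intro n
    rw [Complex.ofReal_cpow (by positivity)]
    push_cast
    rw [Complex.cpow_neg, one_div]
  have h1 : LSeriesHasSum 1 ((5 / 2 : ℝ) : ℂ) (Z : ℂ) := by
    rw [LSeriesHasSum, ← hasSum_nat_add_iff' 1]
    simpa [LSeries.term_def, e] using Complex.hasSum_ofReal.2 hZ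
  have h2 := h1.convolution h1
  rw [LSeriesHasSum, ← hasSum_nat_add_iff' 1] at h2
  have h3 (n : ℕ) : (((n + 1).divisors.card * ((n : ℝ) + 1) ^ (-(5 / 2) : ℝ) : ℝ) : ℂ) =
      LSeries.term (LSeries.convolution 1 1) ((5 / 2 : ℝ) : ℂ) (n + 1) := by
    rw [Complex.ofReal_mul, e, LSeries.term_of_ne_zero n.succ_ne_zero, LSeries.convolution_def]
    simp [← Nat.map_div_right_divisors, div_eq_mul_inv]
  rw [← Complex.hasSum_ofReal]
  simp_rw [h3]
  simpa using h2

theorem norm_coeff_div_pow_le {k m : ℕ} (hk : 6 ≤ k) (hm : k - 1 ≤ m) {a : ℕ → ℂ}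
    (ha : ∀ n : ℕ, 1 ≤ n → ‖a n‖ ≤ (n.divisors.card : ℝ) * (n : ℝ) ^ (((k : ℝ) - 1) / 2))
    (n : ℕ) :
    ‖a (n + 1)‖ / ((n : ℝ) + 1) ^ m ≤
      ((n + 1).divisors.card : ℝ) * ((n : ℝ) + 1) ^ (-(5 / 2) : ℝ) := by
  have hn : (0 : ℝ) < (n : ℝ) + 1 := by positivity
  have hn1 : (1 : ℝ) ≤ (n : ℝ) + 1 := by linarith [n.cast_nonneg (α := ℝ)]
  have h := ha (n + 1) (by omega)
  push_cast at h
  have hk' : (6 : ℝ) ≤ k := by exact_mod_cast hk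
  have hm' : (k : ℝ) ≤ m + 1 := by exact_mod_cast (by omega : k ≤ m + 1)
  calc _ ≤ ((n + 1).divisors.card : ℝ) * ((n : ℝ) + 1) ^ (((k : ℝ) - 1) / 2) /
        ((n : ℝ) + 1) ^ m := by gcongr
    _ = ((n + 1).divisors.card : ℝ) * ((n : ℝ) + 1) ^ (((k : ℝ) - 1) / 2 - m) := by
      rw [Real.rpow_sub hn, Real.rpow_natCast, mul_div_assoc]
    _ ≤ _ := by
      gcongr
      linarith

theorem exp_neg_le_factorial_div_pow (m : ℕ) {y : ℝ} (hy : 0 < y) :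
    Real.exp (-y) ≤ m.factorial / y ^ m := by
  have h := Real.pow_div_factorial_le_exp y hy.le m
  rw [Real.exp_neg, ← inv_div]
  gcongr

theorem cexp_vertical_line (n : ℕ) (x t : ℝ) :
    Complex.exp (2 * (π : ℂ) * I * ((n : ℂ) + 1) * ((x : ℂ) + I * (t : ℂ))) =
      Complex.exp ((2 * π * (n + 1) * x : ℝ) * I) * Real.exp (-(2 * π * (n + 1)) * t) := by
  rw [Complex.ofReal_exp, ← Complex.exp_add]
  congr 1
  push_cast
  linear_combination 2 * (π : ℂ) * (n + 1) * t * Complex.I_mul_I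

theorem norm_term_vertical_line_le {k m : ℕ} (hk : 6 ≤ k) (hm : k - 1 ≤ m) {a : ℕ → ℂ}
    (ha : ∀ n : ℕ, 1 ≤ n → ‖a n‖ ≤ (n.divisors.card : ℝ) * (n : ℝ) ^ (((k : ℝ) - 1) / 2))
    (n : ℕ) (x : ℝ) {t : ℝ} (ht : 0 < t) :
    ‖a (n + 1) * Complex.exp (2 * (π : ℂ) * I * ((n : ℂ) + 1) * ((x : ℂ) + I * (t : ℂ)))‖ ≤
      m.factorial / t ^ m *
        (((n + 1).divisors.card : ℝ) * ((n : ℝ) + 1) ^ (-(5 / 2) : ℝ)) := by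
  rw [cexp_vertical_line, norm_mul, norm_mul, Complex.norm_exp_ofReal_mul_I, one_mul,
    Complex.norm_real, Real.norm_of_nonneg (Real.exp_pos _).le]
  have hexp : Real.exp (-(2 * π * (n + 1)) * t) ≤ m.factorial / (((n : ℝ) + 1) * t) ^ m := by
    refine le_trans (Real.exp_le_exp.2 ?_) (exp_neg_le_factorial_div_pow m (by positivity))
    have : (0 : ℝ) ≤ (n + 1) * t := by positivity
    nlinarith [Real.pi_gt_three]
  calc _ ≤ ‖a (n + 1)‖ * (m.factorial / (((n : ℝ) + 1) * t) ^ m) := by gcongr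
    _ = m.factorial / t ^ m * (‖a (n + 1)‖ / ((n : ℝ) + 1) ^ m) := by
      rw [mul_pow]; field_simp
    _ ≤ _ := by
      gcongr
      exact norm_coeff_div_pow_le hk hm ha n

section VerticalLine

variable {k : ℕ} {a : ℕ → ℂ} {f : ℂ → ℂ} {σ : ℝ} (hk : 6 ≤ k)
  (hσ : HasSum (fun n : ℕ => ((n + 1).divisors.card : ℝ) * ((n : ℝ) + 1) ^ (-(5 / 2) : ℝ)) σ)
  (hf : ∀ z : ℂ, f z = ∑' n : ℕ, a (n + 1) * Complex.exp (2 * (π : ℂ) * I * ((n : ℂ) + 1) * z))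
  (ha : ∀ n : ℕ, 1 ≤ n → ‖a n‖ ≤ (n.divisors.card : ℝ) * (n : ℝ) ^ (((k : ℝ) - 1) / 2))
include hk hσ hf ha

theorem hasSum_vertical_line (x : ℝ) {t : ℝ} (ht : 0 < t) :
    HasSum (fun n : ℕ => a (n + 1) *
      Complex.exp (2 * (π : ℂ) * I * ((n : ℂ) + 1) * ((x : ℂ) + I * (t : ℂ))))
      (f ((x : ℂ) + I * (t : ℂ))) := by
  rw [hf]
  exact (Summable.of_norm_bounded (hσ.summable.mul_left _)
    fun n => norm_term_vertical_line_le hk le_rfl ha n x ht).hasSum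

theorem norm_vertical_line_le {m : ℕ} (hm : k - 1 ≤ m) (x : ℝ) {t : ℝ} (ht : 0 < t) :
    ‖f ((x : ℂ) + I * (t : ℂ))‖ ≤ m.factorial / t ^ m * σ := by
  rw [hf]
  exact tsum_of_norm_bounded (hσ.mul_left _)
    fun n => norm_term_vertical_line_le hk hm ha n x ht

theorem aestronglyMeasurable_vertical_line (x : ℝ) :
    AEStronglyMeasurable (fun t : ℝ => f ((x : ℂ) + I * (t : ℂ)))
      (volume.restrict (Set.Ioi 0)) := by
  refine aestronglyMeasurable_of_tendsto_ae atTop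
    (f := fun (n : ℕ) (t : ℝ) => ∑ i ∈ Finset.range n, a (i + 1) *
      Complex.exp (2 * (π : ℂ) * I * ((i : ℂ) + 1) * ((x : ℂ) + I * (t : ℂ))))
    (fun n => Continuous.aestronglyMeasurable (by fun_prop)) ?_
  filter_upwards [ae_restrict_mem measurableSet_Ioi] with t ht
  exact (hasSum_vertical_line hk hσ hf ha x ht).tendsto_sum_nat

theorem norm_mellin_vertical_line_ge (ha1 : a 1 = 1) (x : ℝ) :
    ((k - 2).factorial : ℝ) / (2 * π) ^ (k - 1) * (2 - σ) ≤
      ‖mellin (fun t : ℝ => f ((x : ℂ) + I * (t : ℂ))) ((k - 1 : ℕ) : ℂ)‖ := by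
  set b : ℕ → ℂ := fun n => a (n + 1) * Complex.exp ((2 * π * (n + 1) * x : ℝ) * I) with hb
  have hbn (n : ℕ) : ‖b n‖ = ‖a (n + 1)‖ := by
    simp only [hb, norm_mul, Complex.norm_exp_ofReal_mul_I, mul_one]
  have hle (n : ℕ) : ‖b n‖ / (2 * π * (n + 1)) ^ (k - 1) ≤ 1 / (2 * π) ^ (k - 1) *
      (((n + 1).divisors.card : ℝ) * ((n : ℝ) + 1) ^ (-(5 / 2) : ℝ)) := by
    rw [hbn, mul_pow, one_div, mul_comm ((2 * π) ^ (k - 1)), ← div_div, div_eq_inv_mul]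
    gcongr
    exact norm_coeff_div_pow_le hk le_rfl ha n
  have hM := hasSum_mellin (a := b) (p := fun n : ℕ => 2 * π * ((n : ℝ) + 1))
    (F := fun t : ℝ => f ((x : ℂ) + I * (t : ℂ))) (s := ((k - 1 : ℕ) : ℂ))
    (fun n => Or.inr (by positivity))
    (by rw [Complex.natCast_re]; exact_mod_cast (by omega : 0 < k - 1))
    (fun t ht => by
      convert hasSum_vertical_line hk hσ hf ha x ht using 2 with n
      rw [cexp_vertical_line, ← mul_assoc])
    (by
      simp_rw [Complex.natCast_re, Real.rpow_natCast]
      exact Summable.of_nonneg_of_le (fun n => by positivity) hle (hσ.summable.mul_left _))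
  have hΓ : Complex.Gamma ((k - 1 : ℕ) : ℂ) = (k - 2).factorial := by
    rw [show k - 1 = (k - 2) + 1 by omega, Nat.cast_add_one, Complex.Gamma_nat_eq_factorial]
  simp only [hΓ, Complex.cpow_natCast] at hM
  set G : ℝ := ((k - 2).factorial : ℝ) / (2 * π) ^ (k - 1) with hG
  have hterm (n : ℕ) : ‖((k - 2).factorial : ℂ) * b n / ((2 * π * ((n : ℝ) + 1) : ℝ) : ℂ) ^ (k - 1)‖
      = (k - 2).factorial * (‖b n‖ / (2 * π * (n + 1)) ^ (k - 1)) := by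
    rw [norm_div, norm_mul, norm_pow, Complex.norm_real, Real.norm_of_nonneg (by positivity),
      Complex.norm_natCast, mul_div_assoc]
  have h0 : ‖((k - 2).factorial : ℂ) * b 0 / ((2 * π * (((0 : ℕ) : ℝ) + 1) : ℝ) : ℂ) ^ (k - 1)‖
      = G := by
    rw [hterm, hbn, zero_add, ha1]
    simp [hG, div_eq_mul_inv]
  have hM1 := (hasSum_nat_add_iff' 1).2 hM
  have hσ1 := ((hasSum_nat_add_iff' 1).2 hσ).mul_left G
  simp only [Finset.sum_range_one] at hM1 hσ1
  have hb1 := tsum_of_norm_bounded hσ1 (fun n => by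
    rw [hterm]
    calc _ ≤ ((k - 2).factorial : ℝ) * (1 / (2 * π) ^ (k - 1) * _) := by
          gcongr
          exact hle (n + 1)
      _ = _ := by rw [hG]; ring)
  rw [hM1.tsum_eq] at hb1
  have h3 := norm_sub_norm_le
    (((k - 2).factorial : ℂ) * b 0 / ((2 * π * (((0 : ℕ) : ℝ) + 1) : ℝ) : ℂ) ^ (k - 1))
    (mellin (fun t : ℝ => f ((x : ℂ) + I * (t : ℂ))) ((k - 1 : ℕ) : ℂ))
  rw [norm_sub_rev] at h3
  rw [h0] at h3
  rw [show σ - (((0 + 1 : ℕ).divisors.card : ℝ) * (((0 : ℕ) : ℝ) + 1) ^ (-(5 / 2) : ℝ)) = σ - 1 by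
    simp] at hb1
  have h4 := h3.trans hb1
  linarith

end VerticalLine

theorem modular_reflection {k N : ℕ} {f : ℂ → ℂ}
    (hmod : ∀ A B C D : ℤ, A * D - B * C = 1 → (N : ℤ) ∣ C → ∀ z : ℂ, 0 < z.im →
      f (((A : ℂ) * z + (B : ℂ)) / ((C : ℂ) * z + (D : ℂ))) = ((C : ℂ) * z + (D : ℂ)) ^ k * f z)
    {A B C D : ℤ} (hdet : A * D - B * C = 1) (hN : (N : ℤ) ∣ C) (hC : 0 < C)
    {t : ℝ} (ht : 0 < t) :
    f ((((A : ℝ) / (C : ℝ) : ℝ) : ℂ) + I * (t : ℂ)) = (I / (C * t)) ^ k *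
      f (((-(D : ℝ) / (C : ℝ) : ℝ) : ℂ) + I * ((((C : ℝ) ^ 2 * t)⁻¹ : ℝ) : ℂ)) := by
  have hCR : (0 : ℝ) < C := by exact_mod_cast hC
  have hC0 : (C : ℂ) ≠ 0 := by exact_mod_cast hC.ne'
  have ht0 : (t : ℂ) ≠ 0 := by exact_mod_cast ht.ne'
  have hdet' : (A : ℂ) * D - B * C = 1 := by exact_mod_cast hdet
  set z : ℂ := ((-(D : ℝ) / (C : ℝ) : ℝ) : ℂ) + I * ((((C : ℝ) ^ 2 * t)⁻¹ : ℝ) : ℂ) with hz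
  have hzim : 0 < z.im := by
    have : z.im = ((C : ℝ) ^ 2 * t)⁻¹ := by
      rw [hz, Complex.add_im, Complex.ofReal_im, Complex.I_mul_im, Complex.ofReal_re, zero_add]
    rw [this]
    positivity
  have hden : (C : ℂ) * z + D = I / (C * t) := by
    rw [hz]
    push_cast
    field_simp
    ring
  have hnum : ((A : ℂ) * z + B) / (C * z + D) = (((A : ℝ) / (C : ℝ) : ℝ) : ℂ) + I * (t : ℂ) := by
    rw [hden, div_eq_iff (div_ne_zero I_ne_zero (mul_ne_zero hC0 ht0)), hz]
    push_cast
    field_simp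
    linear_combination -(C : ℂ) * t * hdet' - C * t * Complex.I_sq
  rw [← hnum, hmod A B C D hdet hN z hzim, hden]

theorem norm_integral_vertical_line_eq {k N : ℕ} {f : ℂ → ℂ} (hk : 2 ≤ k)
    (hmod : ∀ A B C D : ℤ, A * D - B * C = 1 → (N : ℤ) ∣ C → ∀ z : ℂ, 0 < z.im →
      f (((A : ℂ) * z + (B : ℂ)) / ((C : ℂ) * z + (D : ℂ))) = ((C : ℂ) * z + (D : ℂ)) ^ k * f z)
    {A B C D : ℤ} (hdet : A * D - B * C = 1) (hN : (N : ℤ) ∣ C) (hC : 0 < C) :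
    ‖∫ t in Set.Ioi (0 : ℝ), f ((((A : ℝ) / (C : ℝ) : ℝ) : ℂ) + I * (t : ℂ))‖ =
      (C : ℝ) ^ (k - 2) * ‖mellin (fun t : ℝ => f (((-(D : ℝ) / (C : ℝ) : ℝ) : ℂ) + I * (t : ℂ)))
        ((k - 1 : ℕ) : ℂ)‖ := by
  have hCR : (0 : ℝ) < C := by exact_mod_cast hC
  set h : ℝ → ℂ := fun t => f (((-(D : ℝ) / (C : ℝ) : ℝ) : ℂ) + I * (t : ℂ)) with hh
  have hint : ∫ t in Set.Ioi (0 : ℝ), f ((((A : ℝ) / (C : ℝ) : ℝ) : ℂ) + I * (t : ℂ)) =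
      mellin (fun t : ℝ => (I / C) ^ k •
        ((t : ℂ) ^ (-(k : ℂ)) • h ((C : ℝ) ^ 2 * t)⁻¹)) 1 := by
    rw [mellin]
    refine setIntegral_congr_fun measurableSet_Ioi fun t ht => ?_
    simp only [sub_self, Complex.cpow_zero, smul_eq_mul, Complex.cpow_neg,
      Complex.cpow_natCast]
    rw [modular_reflection hmod hdet hN hC ht, ← div_div, div_pow _ (t : ℂ), div_eq_mul_inv,
      mul_assoc, one_mul]
  rw [hint, mellin_const_smul, mellin_cpow_smul, mellin_comp_mul_left (fun v : ℝ => h v⁻¹) _ (by positivity),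
    mellin_comp_inv]
  have hs : -(1 + -(k : ℂ)) = ((k - 1 : ℕ) : ℂ) := by
    rw [Nat.cast_sub (by omega)]
    push_cast
    ring
  rw [hs, Complex.cpow_natCast, norm_smul, norm_smul, norm_pow, norm_pow, norm_div,
    Complex.norm_I, Complex.norm_real, Complex.norm_intCast, Real.norm_of_nonneg (by positivity),
    abs_of_pos hCR, ← mul_assoc]
  congr 1
  obtain ⟨l, rfl⟩ : ∃ l, k = l + 2 := ⟨k - 2, by omega⟩
  rw [show l + 2 - 1 = l + 1 by omega, show l + 2 - 2 = l by omega, div_pow, one_pow]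
  field_simp
  ring

theorem norm_pow_sub_pow_le_of_norm_le {x y : ℂ} {r : ℝ} (hx : ‖x‖ ≤ r) (hy : ‖y‖ ≤ r) (m : ℕ) :
    ‖x ^ (m + 1) - y ^ (m + 1)‖ ≤ (m + 1) * r ^ m * ‖x - y‖ := by
  induction m with
  | zero => simp
  | succ m ih =>
    have hr : 0 ≤ r := (norm_nonneg x).trans hx
    calc ‖x ^ (m + 1 + 1) - y ^ (m + 1 + 1)‖
        = ‖x * (x ^ (m + 1) - y ^ (m + 1)) + y ^ (m + 1) * (x - y)‖ := by ring_nf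
      _ ≤ ‖x‖ * ‖x ^ (m + 1) - y ^ (m + 1)‖ + ‖y‖ ^ (m + 1) * ‖x - y‖ := by
        refine (norm_add_le _ _).trans_eq ?_
        rw [norm_mul, norm_mul, norm_pow]
      _ ≤ r * ((m + 1) * r ^ m * ‖x - y‖) + r ^ (m + 1) * ‖x - y‖ := by gcongr
      _ = _ := by push_cast; ring

/-- If `g` has controlled first moment and `∫ g` is bounded below, the zeros of
`Y ↦ ∫ g(t) (it - Y) ^ (m + 1) dt` are bounded. -/
theorem norm_le_of_integral_mul_pow_eq_zero {g : ℝ → ℂ} {m : ℕ} {P Q L : ℝ} (hL : 0 < L)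
    (hg : AEStronglyMeasurable g (volume.restrict (Set.Ioi 0)))
    (hQ : ∀ t : ℝ, 0 < t → ‖g t‖ ≤ Q * (1 + t ^ 2)⁻¹)
    (hP : ∀ t : ℝ, 0 < t → ‖g t‖ * (t * (1 + t) ^ m) ≤ P * (1 + t ^ 2)⁻¹)
    (hLg : L ≤ ‖∫ t in Set.Ioi (0 : ℝ), g t‖) {Y : ℂ} (hY : 1 ≤ ‖Y‖)
    (h0 : ∫ t in Set.Ioi (0 : ℝ), g t * (I * (t : ℂ) - Y) ^ (m + 1) = 0) :
    ‖Y‖ ≤ (m + 1) * P * (π / 2) / L := by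
  set R : ℝ → ℂ := fun t => (I * (t : ℂ) - Y) ^ (m + 1) - (-Y) ^ (m + 1) with hR
  have hbase : IntegrableOn (fun t : ℝ => (1 + t ^ 2)⁻¹) (Set.Ioi 0) :=
    integrable_inv_one_add_sq.integrableOn
  have hgR (t : ℝ) (ht : 0 < t) :
      ‖g t * R t‖ ≤ (m + 1) * ‖Y‖ ^ m * P * (1 + t ^ 2)⁻¹ := by
    have hIt : ‖I * (t : ℂ)‖ = t := by
      rw [norm_mul, Complex.norm_I, one_mul, Complex.norm_real, Real.norm_of_nonneg ht.le]
    have hRt : ‖R t‖ ≤ (m + 1) * ((1 + t) * ‖Y‖) ^ m * t := by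
      have h1 : ‖I * (t : ℂ) - Y‖ ≤ (1 + t) * ‖Y‖ := by
        refine (norm_sub_le _ _).trans ?_
        rw [hIt]
        nlinarith
      have h2 : ‖-Y‖ ≤ (1 + t) * ‖Y‖ := by
        rw [norm_neg]
        nlinarith
      have h3 := norm_pow_sub_pow_le_of_norm_le h1 h2 m
      rwa [sub_neg_eq_add, sub_add_cancel, hIt] at h3
    calc ‖g t * R t‖ ≤ ‖g t‖ * ((m + 1) * ((1 + t) * ‖Y‖) ^ m * t) := by
          rw [norm_mul]
          gcongr
      _ = (m + 1) * ‖Y‖ ^ m * (‖g t‖ * (t * (1 + t) ^ m)) := by rw [mul_pow]; ring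
      _ ≤ (m + 1) * ‖Y‖ ^ m * (P * (1 + t ^ 2)⁻¹) :=
        mul_le_mul_of_nonneg_left (hP t ht) (by positivity)
      _ = _ := by ring
  have hgint : IntegrableOn g (Set.Ioi 0) :=
    (hbase.const_mul Q).mono' hg
      ((ae_restrict_mem measurableSet_Ioi).mono fun t ht => hQ t ht)
  have hgRae : ∀ᵐ t ∂volume.restrict (Set.Ioi (0 : ℝ)),
      ‖g t * R t‖ ≤ (m + 1) * ‖Y‖ ^ m * P * (1 + t ^ 2)⁻¹ :=
    (ae_restrict_mem measurableSet_Ioi).mono fun t ht => hgR t ht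
  have hgRint : IntegrableOn (fun t => g t * R t) (Set.Ioi 0) :=
    (hbase.const_mul _).mono'
      (hg.mul (Continuous.aestronglyMeasurable (by simp only [hR]; fun_prop))) hgRae
  have hsplit : (∫ t in Set.Ioi (0 : ℝ), g t) * (-Y) ^ (m + 1) =
      -∫ t in Set.Ioi (0 : ℝ), g t * R t := by
    rw [eq_neg_iff_add_eq_zero, ← integral_mul_const, ← integral_add (hgint.mul_const _) hgRint,
      ← h0]
    congr 1 with t
    simp only [hR]
    ring
  have hnorm := norm_integral_le_of_norm_le (hbase.const_mul _) hgRae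
  rw [integral_const_mul, integral_Ioi_inv_one_add_sq, Real.arctan_zero, sub_zero, ← norm_neg,
    ← hsplit, norm_mul, norm_pow, norm_neg, pow_succ] at hnorm
  have hYm : 0 < ‖Y‖ ^ m := by positivity
  rw [le_div_iff₀ hL]
  refine le_of_mul_le_mul_left ?_ hYm
  calc ‖Y‖ ^ m * (‖Y‖ * L) = L * (‖Y‖ ^ m * ‖Y‖) := by ring
    _ ≤ ‖∫ t in Set.Ioi (0 : ℝ), g t‖ * (‖Y‖ ^ m * ‖Y‖) := by gcongr
    _ ≤ _ := hnorm
    _ = _ := by ring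

section Decay

variable {k : ℕ} {c S t G : ℝ} (hk : 3 ≤ k) (hc : 1 ≤ c) (hS : 0 ≤ S) (ht : 0 < t)
  (h1 : G ≤ k.factorial / t ^ k * S)
include hk hc hS ht h1

theorem le_inv_one_add_sq_of_decay
    (h2 : G ≤ (1 / (c * t)) ^ k * (k.factorial / ((c ^ 2 * t)⁻¹) ^ k * S)) :
    G ≤ 2 * k.factorial * S * c ^ k * (1 + t ^ 2)⁻¹ := by
  rw [← div_eq_mul_inv, le_div_iff₀ (by positivity)]
  rcases le_total t 1 with h | h
  · have e : (1 / (c * t)) ^ k * (k.factorial / ((c ^ 2 * t)⁻¹) ^ k * S)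
        = k.factorial * S * c ^ k := by
      simp only [inv_pow, div_pow, mul_pow, one_pow, ← pow_mul]
      field_simp
      ring
    rw [e] at h2
    calc G * (1 + t ^ 2) ≤ k.factorial * S * c ^ k * (1 + 1 ^ 2) := by gcongr
      _ = _ := by ring
  · calc G * (1 + t ^ 2) ≤ k.factorial / t ^ k * S * (t ^ 2 + t ^ 2) := by gcongr; nlinarith
      _ ≤ k.factorial / t ^ 2 * S * (t ^ 2 + t ^ 2) := by gcongr; omega
      _ = 2 * k.factorial * S * 1 := by field_simp; ring
      _ ≤ _ := by gcongr; exact one_le_pow₀ hc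

theorem mul_le_inv_one_add_sq_of_decay
    (h2 : G ≤ (1 / (c * t)) ^ k * ((k - 1).factorial / ((c ^ 2 * t)⁻¹) ^ (k - 1) * S)) :
    G * (t * (1 + t) ^ (k - 3)) ≤
      2 ^ (k - 2) * k.factorial * S * c ^ (k - 2) * (1 + t ^ 2)⁻¹ := by
  obtain ⟨l, rfl⟩ : ∃ l, k = l + 3 := ⟨k - 3, by omega⟩
  simp only [Nat.add_sub_cancel, show l + 3 - 2 = l + 1 by omega,
    show l + 3 - 1 = l + 2 by omega] at h2 ⊢
  rw [← div_eq_mul_inv, le_div_iff₀ (by positivity)]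
  rcases le_total t 1 with h | h
  · have e : (1 / (c * t)) ^ (l + 3) * ((l + 2).factorial / ((c ^ 2 * t)⁻¹) ^ (l + 2) * S)
        = (l + 2).factorial * S * c ^ (l + 1) / t := by
      simp only [inv_pow, div_pow, mul_pow, one_pow, ← pow_mul]
      field_simp
      ring
    rw [e] at h2
    calc G * (t * (1 + t) ^ l) * (1 + t ^ 2)
        ≤ (l + 2).factorial * S * c ^ (l + 1) / t * (t * (1 + 1) ^ l) * (1 + 1 ^ 2) := by gcongr
      _ = 2 ^ (l + 1) * (l + 2).factorial * S * c ^ (l + 1) := by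
        field_simp
        ring
      _ ≤ _ := by
        gcongr
        omega
  · calc G * (t * (1 + t) ^ l) * (1 + t ^ 2)
        ≤ (l + 3).factorial / t ^ (l + 3) * S * (t * (t + t) ^ l) * (t ^ 2 + t ^ 2) := by
          gcongr; nlinarith
      _ = 2 ^ (l + 1) * (l + 3).factorial * S * 1 := by
        rw [← two_mul, mul_pow]
        field_simp
        ring
      _ ≤ _ := by gcongr; exact one_le_pow₀ hc

end Decay

/-- For even `k ≥ 6` there is a constant `K` depending only on `k` such that:
whenever `f` is modular of weight `k` for `Γ₀(N)` with `a(1) = 1` and Deligne bound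
`|a(n)| ≤ d(n) n^{(k-1)/2}`, and `γ = (a b; c d) ∈ SL₂(ℤ)` with `N ∣ c`, `c > 0`, every
complex zero `x₀` of the period polynomial `r_{f,γ}` satisfies `|x₀| ≤ K (1 + |a/c|)`. -/
theorem zeroes_of_period_polynomials_are_bounded
    (k : ℕ) (hk : 6 ≤ k) (hke : Even k) :
    ∃ K : ℝ, ∀ N : ℕ, 1 ≤ N → ∀ a : ℕ → ℂ, ∀ f : ℂ → ℂ,
      (∀ z : ℂ, f z = ∑' n : ℕ, a (n + 1) * Complex.exp (2 * (π : ℂ) * I * ((n : ℂ) + 1) * z)) →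
      (∀ A B C D : ℤ, A * D - B * C = 1 → (N : ℤ) ∣ C → ∀ z : ℂ, 0 < z.im →
        f (((A : ℂ) * z + (B : ℂ)) / ((C : ℂ) * z + (D : ℂ)))
          = ((C : ℂ) * z + (D : ℂ)) ^ k * f z) →
      a 1 = 1 →
      (∀ n : ℕ, 1 ≤ n → ‖a n‖ ≤ (n.divisors.card : ℝ) * (n : ℝ) ^ (((k : ℝ) - 1) / 2)) →
      ∀ A B C D : ℤ, A * D - B * C = 1 → (N : ℤ) ∣ C → 0 < C →
      ∀ x₀ : ℂ,
        (((k - 1).factorial : ℂ)⁻¹ * I * ∫ t in Set.Ioi (0 : ℝ),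
            f ((((A : ℝ) / (C : ℝ) : ℝ) : ℂ) + I * (t : ℂ)) *
              ((((A : ℝ) / (C : ℝ) : ℝ) : ℂ) + I * (t : ℂ) - x₀) ^ (k - 2)) = 0 →
        ‖x₀‖ ≤ K * (1 + |(A : ℝ) / (C : ℝ)|) := by
  obtain ⟨σ, hσ2, hσ⟩ := exists_hasSum_card_divisors
  have hσ0 : 0 ≤ σ := hσ.nonneg fun n => by positivity
  set δ : ℝ := ((k - 2).factorial : ℝ) / (2 * π) ^ (k - 1) * (2 - σ) with hδ
  have hδ0 : 0 < δ := mul_pos (by positivity) (by linarith)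
  set M : ℝ := 2 ^ (k - 2) * k.factorial * σ with hM
  have hM0 : 0 ≤ M := by positivity
  set b : ℝ := ((k - 3 : ℕ) + 1) * M * (π / 2) / δ with hb
  have hb0 : 0 ≤ b := by positivity
  refine ⟨1 + b, ?_⟩
  intro N _ a f hf hmod ha1 ha A B C D hdet hN hC x₀ hzero
  have hC1 : (1 : ℝ) ≤ C := by exact_mod_cast hC
  set x : ℝ := (A : ℝ) / (C : ℝ) with hx
  have hCm : (0 : ℝ) < (C : ℝ) ^ (k - 2) := by positivity
  have hcusp (m : ℕ) (hm : k - 1 ≤ m) (t : ℝ) (ht : 0 < t) :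
      ‖f ((x : ℂ) + I * (t : ℂ))‖ ≤
        (1 / (C * t)) ^ k * (m.factorial / (((C : ℝ) ^ 2 * t)⁻¹) ^ m * σ) := by
    rw [modular_reflection hmod hdet hN hC ht, norm_mul, norm_pow, norm_div, norm_mul,
      Complex.norm_I, Complex.norm_intCast, Complex.norm_real, Real.norm_of_nonneg ht.le,
      abs_of_pos (by linarith)]
    gcongr
    exact norm_vertical_line_le hk hσ hf ha hm _ (by positivity)
  have htop (t : ℝ) (ht : 0 < t) : ‖f ((x : ℂ) + I * (t : ℂ))‖ ≤ k.factorial / t ^ k * σ :=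
    norm_vertical_line_le hk hσ hf ha (by omega) _ ht
  have hlower : (C : ℝ) ^ (k - 2) * δ ≤ ‖∫ t in Set.Ioi (0 : ℝ), f ((x : ℂ) + I * (t : ℂ))‖ := by
    rw [norm_integral_vertical_line_eq (by omega) hmod hdet hN hC]
    gcongr
    exact norm_mellin_vertical_line_ge hk hσ hf ha ha1 _
  have hY : ‖x₀ - x‖ ≤ 1 + b := by
    rcases le_total ‖x₀ - x‖ 1 with h | h
    · linarith
    · have h0 := (mul_eq_zero.1 hzero).resolve_left
        (mul_ne_zero (inv_ne_zero (by exact_mod_cast Nat.factorial_ne_zero _)) I_ne_zero)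
      have hle := norm_le_of_integral_mul_pow_eq_zero (m := k - 3)
        (g := fun t : ℝ => f ((x : ℂ) + I * (t : ℂ)))
        (Q := 2 * k.factorial * σ * (C : ℝ) ^ k) (P := M * (C : ℝ) ^ (k - 2))
        (mul_pos hCm hδ0) (aestronglyMeasurable_vertical_line hk hσ hf ha x)
        (fun t ht => le_inv_one_add_sq_of_decay (by omega) hC1 hσ0 ht (htop t ht)
          (hcusp k (by omega) t ht))
        (fun t ht => mul_le_inv_one_add_sq_of_decay (by omega) hC1 hσ0 ht (htop t ht)
          (hcusp (k - 1) le_rfl t ht))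
        hlower h
        (by
          rw [← h0, show k - 3 + 1 = k - 2 by omega]
          congr 1 with t
          ring)
      have e : ((k - 3 : ℕ) + 1 : ℝ) * (M * (C : ℝ) ^ (k - 2)) * (π / 2) / ((C : ℝ) ^ (k - 2) * δ)
          = b := by
        rw [hb]
        field_simp
      linarith
  calc ‖x₀‖ = ‖(x₀ - x) + x‖ := by rw [sub_add_cancel]
    _ ≤ ‖x₀ - x‖ + ‖(x : ℂ)‖ := norm_add_le _ _
    _ ≤ (1 + b) + |x| := by rw [Complex.norm_real, Real.norm_eq_abs]; gcongr
    _ ≤ (1 + b) * (1 + |x|) := by nlinarith [abs_nonneg x]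
end
end

section
/- Assume Σ_{n≥1} |a(n)|·n^{−(k−1)} < ∞ (which holds under the Hecke bound since k ≥ 4). Let α_0, …, α_{k−2}, β_0, …, β_{k−2} be nonnegative integers, not all zero; set α = Σ_j α_j, β = Σ_j β_j and M = Σ_{j=0}^{k−2} j·(α_j+β_j). Then ∫_0^1 ∫_0^1 ∏_{j=0}^{k−2} (L(f⊗e(y), k−1)·z^j)^{α_j}·conj(L(f⊗e(y), k−1)·z^j)^{β_j} dy dz = L_{f,α,β}(k−1)/(M+1). In probabilistic terms: if Y and Z are independent random variables uniformly distributed on [0,1), the (α,β)-joint moment of the random vector (L(f⊗e(Y),k−1)·Z^j)_{j=0}^{k−2} equals L_{f,α,β}(k−1)/(M+1). -/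
open Complex MeasureTheory Real Filter

noncomputable section

/-- The product of finitely many absolutely convergent series is the absolutely convergent series
over tuples of indices. -/
theorem summable_norm_and_hasSum_prod_pi {ι : Type*} :
    ∀ {N : ℕ} {F : Fin N → ι → ℂ}, (∀ i, Summable fun n => ‖F i n‖) →
      (Summable fun g : Fin N → ι => ‖∏ i, F i (g i)‖) ∧
        HasSum (fun g : Fin N → ι => ∏ i, F i (g i)) (∏ i, ∑' n, F i n)
  | 0, F, _ => by
    refine ⟨(hasSum_fintype _).summable, ?_⟩
    simp
  | N + 1, F, hF => by
    obtain ⟨hs, hsum⟩ := summable_norm_and_hasSum_prod_pi fun i : Fin N => hF i.succ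
    have hnorm := (hF 0).mul_norm hs
    have hprod := (hF 0).of_norm.hasSum.mul hsum hnorm.of_norm
    rw [← (Fin.consEquiv fun _ : Fin (N + 1) => ι).summable_iff,
      ← (Fin.consEquiv fun _ : Fin (N + 1) => ι).hasSum_iff, Fin.prod_univ_succ]
    constructor
    · refine hnorm.congr fun p => ?_
      simp [Fin.consEquiv, Fin.prod_univ_succ]
    · refine hprod.congr_fun fun p => ?_
      simp [Fin.consEquiv, Fin.prod_univ_succ]

/-- Orthogonality of the additive characters on `[0, 1]`. -/
theorem integral_exp_two_pi_I_int_mul (m : ℤ) :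
    ∫ y in (0 : ℝ)..1, Complex.exp (2 * π * I * m * y) = if m = 0 then 1 else 0 := by
  split_ifs with h
  · simp [h]
  · have hm : (2 * π * I * m : ℂ) ≠ 0 := mul_ne_zero Complex.two_pi_I_ne_zero (mod_cast h)
    have h1 : Complex.exp (2 * π * I * m) = 1 :=
      Complex.exp_eq_one_iff.mpr ⟨m, by ring⟩
    rw [integral_exp_mul_complex hm]
    simp [h1]

theorem norm_exp_two_pi_I_int_mul (m : ℤ) (y : ℝ) : ‖Complex.exp (2 * π * I * m * y)‖ = 1 := by
  rw [Complex.norm_exp]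
  simp

/-- The mean value of a product of absolutely convergent exponential series is the sum of its
coefficients of frequency zero. -/
theorem integral_prod_tsum_exp {ι : Type*} [Countable ι] {N : ℕ} (c : Fin N → ι → ℂ)
    (s : Fin N → ι → ℤ) (hc : ∀ i, Summable fun n => ‖c i n‖) :
    ∫ y in (0 : ℝ)..1, ∏ i, ∑' n, c i n * Complex.exp (2 * π * I * (s i n) * y) =
      ∑' g : Fin N → ι, if ∑ i, s i (g i) = 0 then ∏ i, c i (g i) else 0 := by
  have hprod (g : Fin N → ι) (y : ℝ) :
      ∏ i, c i (g i) * Complex.exp (2 * π * I * (s i (g i)) * y) =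
        (∏ i, c i (g i)) * Complex.exp (2 * π * I * ((∑ i, s i (g i) : ℤ) : ℂ) * y) := by
    rw [Finset.prod_mul_distrib, ← Complex.exp_sum, Int.cast_sum, Finset.mul_sum, Finset.sum_mul]
  have hsum (y : ℝ) := (summable_norm_and_hasSum_prod_pi
    (F := fun i n => c i n * Complex.exp (2 * π * I * (s i n) * y))
    (fun i => by simpa only [norm_mul, norm_exp_two_pi_I_int_mul, mul_one] using hc i)).2
  simp only [hprod] at hsum
  have key := intervalIntegral.hasSum_integral_of_dominated_convergence (μ := volume)
    (a := 0) (b := 1) (fun (g : Fin N → ι) (_ : ℝ) => ‖∏ i, c i (g i)‖)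
    (fun g => (by fun_prop : Continuous fun y : ℝ =>
      (∏ i, c i (g i)) * Complex.exp (2 * π * I * ((∑ i, s i (g i) : ℤ) : ℂ) * y)
      ).aestronglyMeasurable)
    (fun g => ae_of_all _ fun y _ => by rw [norm_mul, norm_exp_two_pi_I_int_mul, mul_one])
    (ae_of_all _ fun _ _ => (summable_norm_and_hasSum_prod_pi hc).1)
    intervalIntegrable_const
    (ae_of_all _ fun y _ => hsum y)
  rw [← key.tsum_eq]
  refine tsum_congr fun g => ?_
  rw [intervalIntegral.integral_const_mul, integral_exp_two_pi_I_int_mul, mul_ite, mul_one,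
    mul_zero]

/-- If `∑ |a(n)| n^{-(k-1)} < ∞`, then for nonnegative integers
`α_0, …, α_{k-2}, β_0, …, β_{k-2}` not all zero, with `α = Σ α_j`, `β = Σ β_j` and
`M = Σ j (α_j + β_j)`, one has
`∫_0^1 ∫_0^1 ∏_j (L(f⊗e(y),k-1) z^j)^{α_j} conj(L(f⊗e(y),k-1) z^j)^{β_j} dy dz
  = L_{f,α,β}(k-1) / (M+1)`. -/
theorem moments_of_limiting_random_vector
    (k : ℕ) (hk : 4 ≤ k) (hke : Even k) (a : ℕ → ℂ)
    (hsum : Summable (fun n : ℕ => ‖a (n + 1)‖ / ((n : ℝ) + 1) ^ (k - 1)))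
    (αv βv : Fin (k - 1) → ℕ) (hnz : ¬(αv = 0 ∧ βv = 0))
    (α β M : ℕ) (hα : α = ∑ j : Fin (k - 1), αv j) (hβ : β = ∑ j : Fin (k - 1), βv j)
    (hM : M = ∑ j : Fin (k - 1), (j : ℕ) * (αv j + βv j))
    (L : ℝ → ℂ)
    (hL : ∀ y : ℝ, L y = ∑' n : ℕ,
      a (n + 1) * Complex.exp (2 * (π : ℂ) * I * ((n : ℂ) + 1) * (y : ℂ)) /
        ((n : ℂ) + 1) ^ (k - 1))
    (term : (Fin (α + β) → ℕ) → ℂ)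
    (hterm : ∀ g : Fin (α + β) → ℕ, term g =
      if (∑ i : Fin (α + β), if (i : ℕ) < α then g i + 1 else 0)
          = (∑ i : Fin (α + β), if (i : ℕ) < α then 0 else g i + 1) then
        ∏ i : Fin (α + β),
          (if (i : ℕ) < α then a (g i + 1) else (starRingEnd ℂ) (a (g i + 1))) /
            ((g i : ℂ) + 1) ^ (k - 1)
      else 0) :
    (∫ y in (0 : ℝ)..1, ∫ z in (0 : ℝ)..1,
        ∏ j : Fin (k - 1),
          (L y * (z : ℂ) ^ (j : ℕ)) ^ (αv j) *
            ((starRingEnd ℂ) (L y * (z : ℂ) ^ (j : ℕ))) ^ (βv j))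
      = (∑' g : Fin (α + β) → ℕ, term g) / ((M : ℂ) + 1) := by
  have hinner (y : ℝ) : (∫ z in (0 : ℝ)..1, ∏ j : Fin (k - 1),
      (L y * (z : ℂ) ^ (j : ℕ)) ^ (αv j) *
        ((starRingEnd ℂ) (L y * (z : ℂ) ^ (j : ℕ))) ^ (βv j)) =
      L y ^ α * (starRingEnd ℂ) (L y) ^ β / ((M : ℂ) + 1) := by
    have hint (z : ℝ) : (∏ j : Fin (k - 1), (L y * (z : ℂ) ^ (j : ℕ)) ^ (αv j) *
        ((starRingEnd ℂ) (L y * (z : ℂ) ^ (j : ℕ))) ^ (βv j)) =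
        L y ^ α * (starRingEnd ℂ) (L y) ^ β * ((z ^ M : ℝ) : ℂ) := by
      rw [hα, hβ, hM, Complex.ofReal_pow, ← Finset.prod_pow_eq_pow_sum,
        ← Finset.prod_pow_eq_pow_sum, ← Finset.prod_pow_eq_pow_sum, ← Finset.prod_mul_distrib,
        ← Finset.prod_mul_distrib]
      refine Finset.prod_congr rfl fun j _ => ?_
      simp only [map_mul, map_pow, Complex.conj_ofReal]
      ring
    simp only [hint]
    rw [intervalIntegral.integral_const_mul, intervalIntegral.integral_ofReal, integral_pow]
    simp [div_eq_mul_inv]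
  simp only [hinner]
  rw [intervalIntegral.integral_div]
  congr 1
  let c : Fin (α + β) → ℕ → ℂ := fun i n =>
    (if (i : ℕ) < α then a (n + 1) else (starRingEnd ℂ) (a (n + 1))) / ((n : ℂ) + 1) ^ (k - 1)
  let s : Fin (α + β) → ℕ → ℤ := fun i n => if (i : ℕ) < α then n + 1 else -(n + 1)
  have hc (i : Fin (α + β)) : Summable fun n => ‖c i n‖ := by
    refine hsum.congr fun n => ?_
    have hn : ‖(n : ℂ) + 1‖ = (n : ℝ) + 1 := mod_cast Complex.norm_natCast (n + 1)
    simp only [c, norm_div, norm_pow, hn]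
    split_ifs <;> simp
  have hfactor (y : ℝ) (i : Fin (α + β)) :
      ∑' n, c i n * Complex.exp (2 * π * I * (s i n) * y) =
        if (i : ℕ) < α then L y else (starRingEnd ℂ) (L y) := by
    split_ifs with h
    · rw [hL]
      refine tsum_congr fun n => ?_
      simp only [c, s, if_pos h]
      push_cast
      ring
    · rw [hL, Complex.conj_tsum]
      refine tsum_congr fun n => ?_
      simp only [c, s, if_neg h, map_div₀, map_mul, map_pow, map_add, map_one, map_natCast,
        ← Complex.exp_conj, Complex.conj_ofReal, Complex.conj_I, map_ofNat]
      push_cast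
      ring_nf
  have hprod (y : ℝ) : L y ^ α * (starRingEnd ℂ) (L y) ^ β =
      ∏ i : Fin (α + β), ∑' n, c i n * Complex.exp (2 * π * I * (s i n) * y) := by
    simp [hfactor, Fin.prod_univ_add]
  simp only [hprod]
  rw [integral_prod_tsum_exp c s hc]
  refine tsum_congr fun g => ?_
  rw [hterm]
  refine if_congr ?_ rfl rfl
  have hs : ∑ i, s i (g i) =
      ((∑ i : Fin (α + β), if (i : ℕ) < α then g i + 1 else 0 : ℕ) : ℤ) -
        (∑ i : Fin (α + β), if (i : ℕ) < α then 0 else g i + 1 : ℕ) := by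
    rw [Nat.cast_sum, Nat.cast_sum, ← Finset.sum_sub_distrib]
    refine Finset.sum_congr rfl fun i _ => ?_
    simp only [s]
    split_ifs <;> simp
  rw [hs, sub_eq_zero, Nat.cast_inj]
end
end
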